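/- Let d ≥ 3 and v : ℝ^d → ℝ be nonnegative, bounded, measurable, with bounded support. Let W_x, W'_y be independent d-dimensional Brownian motions started at x and y, and Y_x(t) = ∫₀^t v(W_x(s))ds, Y'_y(t) = ∫₀^t v(W'_y(s))ds. Then for all t > 0 and integers k ≥ 0, E[(Y_x(t) + Y'_y(t))^k]/k! ≥ ∑_{j=0}^{k} ∫_{0<s₁<⋯<s_k<t} ∫_{(ℝ^d)^k} q^{x,y}_{t,k}(s,z) · Q_j(s,z) · ∏_{i=1}^k v(z_i) dz ds, where q^{x,y}_{t,k} is the Brownian bridge finite-dimensional density and Q_j(s,z) = q(t; y−x)/q(s_{j+1}−s_j; z_{j+1}−z_j), with the conventions s₀=0, s_{k+1}=t, z₀=x, z_{k+1}=y. -/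

import Mathlib

open MeasureTheory Real Filter Topology ProbabilityTheory

noncomputable section

/-- Euclidean space `ℝ^d`. -/
abbrev Euc (d : ℕ) := EuclideanSpace ℝ (Fin d)

/-- The Brownian transition density `q(s; w) = (2πs)^{-d/2} exp(-|w|²/(2s))`. -/
def heatKernel (d : ℕ) (s : ℝ) (w : Euc d) : ℝ :=
  (2 * π * s) ^ (-(d : ℝ) / 2) * Real.exp (-‖w‖ ^ 2 / (2 * s))

/-- Joint density of a Brownian motion started at `x`, at times `s 0 < s 1 < ⋯`. -/
def jointDensity (d : ℕ) {k : ℕ} (x : Euc d) (s : Fin k → ℝ) (z : Fin k → Euc d) : ℝ :=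
  ∏ j : Fin k,
    heatKernel d (s j - if (j : ℕ) = 0 then 0 else s ⟨(j : ℕ) - 1, lt_of_le_of_lt (Nat.sub_le _ _) j.isLt⟩)
      (z j - if (j : ℕ) = 0 then x else z ⟨(j : ℕ) - 1, lt_of_le_of_lt (Nat.sub_le _ _) j.isLt⟩)

/-- Joint density of the Brownian bridge from `a` to `b` in time `t`, at interior times `s`. -/
def bridgeDensity (d : ℕ) {k : ℕ} (t : ℝ) (a b : Euc d) (s : Fin k → ℝ) (z : Fin k → Euc d) : ℝ :=
  jointDensity d a (Fin.snoc s t) (Fin.snoc z b) / heatKernel d t (b - a)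

/-- The open ordered simplex `0 < s₁ < ⋯ < s_k < t`. -/
def simplex (k : ℕ) (t : ℝ) : Set (Fin k → ℝ) :=
  {s | StrictMono s ∧ ∀ i, 0 < s i ∧ s i < t}

/-- `W` is a standard `d`-dimensional Brownian motion started at `x`, characterized by
continuous paths and finite-dimensional densities given by products of heat kernels. -/
def IsBrownianMotion {Ω : Type*} [MeasureSpace Ω] {d : ℕ} (x : Euc d)
    (W : ℝ → Ω → Euc d) : Prop :=
  (∀ ω, W 0 ω = x) ∧ (∀ ω, Continuous fun s => W s ω) ∧
  ∀ (k : ℕ) (s : Fin (k + 1) → ℝ), StrictMono s → (∀ i, 0 < s i) →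
    Measure.map (fun ω (i : Fin (k + 1)) => W (s i) ω) (ℙ : Measure Ω) =
      (volume : Measure (Fin (k + 1) → Euc d)).withDensity
        (fun z => ENNReal.ofReal (jointDensity d x s z))

/-- `X` is a `d`-dimensional Brownian bridge from `a` to `b` in time `t`. -/
def IsBrownianBridge {Ω : Type*} [MeasureSpace Ω] {d : ℕ} (t : ℝ) (a b : Euc d)
    (X : ℝ → Ω → Euc d) : Prop :=
  (∀ ω, X 0 ω = a) ∧ (∀ ω, X t ω = b) ∧
  (∀ ω, ContinuousOn (fun s => X s ω) (Set.Icc 0 t)) ∧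
  ∀ (k : ℕ) (s : Fin (k + 1) → ℝ), StrictMono s → (∀ i, 0 < s i ∧ s i < t) →
    Measure.map (fun ω (i : Fin (k + 1)) => X (s i) ω) (ℙ : Measure Ω) =
      (volume : Measure (Fin (k + 1) → Euc d)).withDensity
        (fun z => ENNReal.ofReal (bridgeDensity d t a b s z))

/-- The path integral `∫₀^t v(X_s) ds`. -/
def pathInt {Ω : Type*} {d : ℕ} (v : Euc d → ℝ) (X : ℝ → Ω → Euc d) (t : ℝ) (ω : Ω) : ℝ :=
  ∫ s in Set.Ioc (0 : ℝ) t, v (X s ω)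

/-- The total path integral `∫₀^∞ v(X_s) ds`. -/
def pathIntInf {Ω : Type*} {d : ℕ} (v : Euc d → ℝ) (X : ℝ → Ω → Euc d) (ω : Ω) : ℝ :=
  ∫ s in Set.Ioi (0 : ℝ), v (X s ω)

/-- The density ratio `Q_{j} = q(t; y - x)/q(Δ_j s; Δ_j z)` with the conventions
`s₀ = 0`, `s_{k+1} = t`, `z₀ = x`, `z_{k+1} = y`. -/
def Qratio (d : ℕ) {k : ℕ} (t : ℝ) (x y : Euc d) (s : Fin k → ℝ) (z : Fin k → Euc d)
    (j : Fin (k + 1)) : ℝ :=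
  heatKernel d t (y - x) /
    heatKernel d
      ((Fin.cons 0 (Fin.snoc s t) : Fin (k + 2) → ℝ) j.succ -
        (Fin.cons 0 (Fin.snoc s t) : Fin (k + 2) → ℝ) j.castSucc)
      ((Fin.cons x (Fin.snoc z y) : Fin (k + 2) → Euc d) j.succ -
        (Fin.cons x (Fin.snoc z y) : Fin (k + 2) → Euc d) j.castSucc)

open scoped ENNReal

theorem sum_lintegral_le_lintegral_sum {ι α : Type*} [MeasurableSpace α] (μ : Measure α)
    (u : Finset ι) (f : ι → α → ℝ≥0∞) :
    ∑ i ∈ u, ∫⁻ a, f i a ∂μ ≤ ∫⁻ a, ∑ i ∈ u, f i a ∂μ := by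
  classical
  induction u using Finset.induction_on with
  | empty => simp
  | insert i u hi ih =>
    simp only [Finset.sum_insert hi]
    exact (add_le_add_right ih _).trans (le_lintegral_add _ _)

/-! ### Integrals of products over an ordered simplex -/

theorem lintegral_pi_prod_eq_pow (μ : Measure ℝ) [SigmaFinite μ] {f : ℝ → ℝ≥0∞}
    (hf : Measurable f) (n : ℕ) :
    ∫⁻ s : Fin n → ℝ, ∏ i, f (s i) ∂(Measure.pi fun _ => μ) = (∫⁻ r, f r ∂μ) ^ n := by
  induction n with
  | zero => simp
  | succ n ih =>
    rw [← ((measurePreserving_piFinSuccAbove (fun _ => μ) 0).symm).lintegral_comp_emb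
      (MeasurableEquiv.measurableEmbedding _)]
    simp only [MeasurableEquiv.piFinSuccAbove_symm_apply, Fin.insertNthEquiv, Equiv.coe_fn_mk,
      Fin.prod_univ_succ, Fin.insertNth_zero, Fin.cons_zero, Fin.cons_succ, cast_eq]
    rw [lintegral_prod_mul (f := f) (g := fun s : Fin n → ℝ => ∏ i, f (s i)) hf.aemeasurable
      (Finset.measurable_fun_prod _ fun i _ => hf.comp (measurable_pi_apply i)).aemeasurable,
      ih, pow_succ']

theorem measurableSet_strictMono (k : ℕ) : MeasurableSet {s : Fin k → ℝ | StrictMono s} := by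
  simp only [StrictMono, Set.ofPred_forall]
  exact MeasurableSet.iInter fun i => MeasurableSet.iInter fun j => MeasurableSet.iInter fun _ =>
    measurableSet_lt (measurable_pi_apply i) (measurable_pi_apply j)

theorem measurableSet_simplex (k : ℕ) (t : ℝ) : MeasurableSet (simplex k t) := by
  have h : simplex k t = {s | StrictMono s} ∩ ⋂ i, ({s | 0 < s i} ∩ {s | s i < t}) := by
    ext s
    simp [simplex]
  rw [h]
  exact (measurableSet_strictMono k).inter <| MeasurableSet.iInter fun i =>
    (measurableSet_lt measurable_const (measurable_pi_apply i)).inter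
      (measurableSet_lt (measurable_pi_apply i) measurable_const)

theorem factorial_mul_setLIntegral_strictMono_le {f : ℝ → ℝ≥0∞} (hf : Measurable f) (k : ℕ) :
    (k.factorial : ℝ≥0∞) * ∫⁻ s in {s : Fin k → ℝ | StrictMono s}, ∏ i, f (s i) ≤
      (∫⁻ r, f r) ^ k := by
  let P : Equiv.Perm (Fin k) → Set (Fin k → ℝ) := fun σ => {s | StrictMono (s ∘ σ)}
  have hcomp (σ : Equiv.Perm (Fin k)) : Measurable fun s : Fin k → ℝ => s ∘ σ :=
    measurable_pi_lambda _ fun i => measurable_pi_apply (σ i)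
  have hP (σ) : MeasurableSet (P σ) := hcomp σ (measurableSet_strictMono k)
  have hdisj : Pairwise (Function.onFun Disjoint P) := by
    intro σ τ hne
    refine Set.disjoint_left.2 fun s hσ hτ => hne ?_
    have hinj : Function.Injective s := by
      have := hσ.injective.comp σ.symm.injective
      simpa [Function.comp_assoc] using this
    ext i
    exact congrArg _ (hinj (congrFun (Tuple.unique_monotone hσ.monotone hτ.monotone) i))
  have hperm (σ : Equiv.Perm (Fin k)) :
      ∫⁻ s in P σ, ∏ i, f (s i) = ∫⁻ s in {s : Fin k → ℝ | StrictMono s}, ∏ i, f (s i) := by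
    have hmp := (volume_measurePreserving_piCongrLeft (fun _ : Fin k => ℝ) σ).symm
    have hval (s : Fin k → ℝ) :
        (MeasurableEquiv.piCongrLeft (fun _ : Fin k => ℝ) σ).symm s = s ∘ σ := rfl
    have hpre : P σ = (MeasurableEquiv.piCongrLeft (fun _ : Fin k => ℝ) σ).symm ⁻¹'
        {s | StrictMono s} := rfl
    rw [hpre]
    refine Eq.trans ?_ (hmp.setLIntegral_comp_preimage_emb (MeasurableEquiv.measurableEmbedding _)
      (fun s => ∏ i, f (s i)) _)
    refine lintegral_congr fun s => ?_
    rw [hval]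
    exact (Equiv.prod_comp σ fun i => f (s i)).symm
  calc (k.factorial : ℝ≥0∞) * ∫⁻ s in {s : Fin k → ℝ | StrictMono s}, ∏ i, f (s i)
      = ∑' σ, ∫⁻ s in P σ, ∏ i, f (s i) := by
        rw [tsum_fintype]
        simp [hperm, Fintype.card_perm]
    _ = ∫⁻ s in ⋃ σ, P σ, ∏ i, f (s i) := (lintegral_iUnion hP hdisj _).symm
    _ ≤ ∫⁻ s : Fin k → ℝ, ∏ i, f (s i) := setLIntegral_le_lintegral _ _
    _ = _ := lintegral_pi_prod_eq_pow volume hf k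

theorem factorial_mul_setLIntegral_simplex_le {f : ℝ → ℝ≥0∞} (hf : Measurable f) (k : ℕ) (t : ℝ) :
    (k.factorial : ℝ≥0∞) * ∫⁻ s in simplex k t, ∏ i, f (s i) ≤
      (∫⁻ r in Set.Ioc 0 t, f r) ^ k := by
  rw [← lintegral_indicator measurableSet_Ioc]
  refine le_trans ?_ (factorial_mul_setLIntegral_strictMono_le (hf.indicator measurableSet_Ioc) k)
  refine mul_le_mul_right ?_ _
  calc ∫⁻ s in simplex k t, ∏ i, f (s i)
      = ∫⁻ s in simplex k t, ∏ i, (Set.Ioc 0 t).indicator f (s i) := by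
        refine setLIntegral_congr_fun (measurableSet_simplex k t) fun s hs => ?_
        refine Finset.prod_congr rfl fun i _ => ?_
        have hi : s i ∈ Set.Ioc 0 t := ⟨(hs.2 i).1, (hs.2 i).2.le⟩
        exact (Set.indicator_of_mem hi f).symm
    _ ≤ _ := lintegral_mono_set fun s hs => hs.1

theorem setLIntegral_Ioc_sub_left (f : ℝ → ℝ≥0∞) (t : ℝ) :
    ∫⁻ r in Set.Ioc 0 t, f (t - r) = ∫⁻ r in Set.Ioc 0 t, f r := by
  rw [setLIntegral_congr (Ioo_ae_eq_Ioc (μ := volume)).symm,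
    setLIntegral_congr (Ioo_ae_eq_Ioc (μ := volume)).symm]
  have h := (Measure.measurePreserving_sub_left (volume : Measure ℝ) t).setLIntegral_comp_preimage_emb
    (measurableEmbedding_subLeft t) f (Set.Ioo 0 t)
  simpa using h

theorem sum_prod_ite_le_prod_add {k : ℕ} (a b : Fin k → ℝ≥0∞) :
    ∑ j : Fin (k + 1), ∏ i : Fin k, (if (i : ℕ) < j then a i else b i) ≤ ∏ i, (a i + b i) := by
  have hinj : Function.Injective
      fun j : Fin (k + 1) => Finset.univ.filter fun i : Fin k => (i : ℕ) < j := by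
    have hcard (j : Fin (k + 1)) : (Finset.univ.filter fun i : Fin k => (i : ℕ) < j).card = j := by
      simp [Fin.card_filter_val_lt, Nat.lt_succ_iff.1 j.isLt]
    exact fun j j' h => Fin.ext (by simpa [hcard] using congrArg Finset.card h)
  rw [Finset.prod_add]
  calc ∑ j : Fin (k + 1), ∏ i : Fin k, (if (i : ℕ) < j then a i else b i)
      = ∑ u ∈ Finset.univ.image
          (fun j : Fin (k + 1) => Finset.univ.filter fun i : Fin k => (i : ℕ) < j),
          (∏ i ∈ u, a i) * ∏ i ∈ Finset.univ \ u, b i := by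
        rw [Finset.sum_image hinj.injOn]
        refine Finset.sum_congr rfl fun j _ => ?_
        rw [Finset.prod_ite, ← Finset.filter_not]
    _ ≤ _ := Finset.sum_le_sum_of_subset (by simp)

/-! ### Heat kernels and joint densities -/

theorem heatKernel_pos {d : ℕ} {s : ℝ} (hs : 0 < s) (w : Euc d) : 0 < heatKernel d s w := by
  unfold heatKernel
  positivity

theorem heatKernel_sub_comm {d : ℕ} (s : ℝ) (w w' : Euc d) :
    heatKernel d s (w - w') = heatKernel d s (w' - w) := by
  simp only [heatKernel, norm_sub_rev]

theorem measurable_heatKernel (d : ℕ) (s : ℝ) : Measurable (heatKernel d s) := by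
  unfold heatKernel
  fun_prop

theorem measurable_jointDensity {d k : ℕ} (x : Euc d) (s : Fin k → ℝ) :
    Measurable (jointDensity d x s) := by
  unfold jointDensity
  refine Finset.measurable_fun_prod _ fun j _ => (measurable_heatKernel d _).comp ?_
  split_ifs <;> fun_prop

theorem jointDensity_eq_prod_range {d k : ℕ} {x : Euc d} {s : Fin k → ℝ} {z : Fin k → Euc d}
    (S : ℕ → ℝ) (Z : ℕ → Euc d) (hS₀ : S 0 = 0) (hZ₀ : Z 0 = x)
    (hS : ∀ i : Fin k, S (i + 1) = s i) (hZ : ∀ i : Fin k, Z (i + 1) = z i) :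
    jointDensity d x s z =
      ∏ i ∈ Finset.range k, heatKernel d (S (i + 1) - S i) (Z (i + 1) - Z i) := by
  rw [Finset.prod_range, jointDensity]
  refine Finset.prod_congr rfl fun ⟨j, hj⟩ _ => ?_
  rw [hS, hZ]
  cases j with
  | zero => simp [hS₀, hZ₀]
  | succ j =>
    have h1 := hS ⟨j, by omega⟩
    have h2 := hZ ⟨j, by omega⟩
    simp only at h1 h2
    simp [h1, h2]

theorem jointDensity_pos {d k : ℕ} (x : Euc d) {s : Fin k → ℝ} (hs : StrictMono s)
    (hs₀ : ∀ i, 0 < s i) (z : Fin k → Euc d) : 0 < jointDensity d x s z := by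
  refine Finset.prod_pos fun j _ => heatKernel_pos ?_ _
  split_ifs with h
  · simpa using hs₀ j
  · exact sub_pos.2 (hs (Fin.lt_def.2 (by simp; omega)))

/-- Dividing the bridge density by its `j`-th increment factor leaves the product of the densities
of a path from `x` and a time-reversed path from `y`. -/
theorem bridgeDensity_mul_Qratio {d j m : ℕ} {t : ℝ} (x y : Euc d) {s : Fin (j + m) → ℝ}
    (hs : s ∈ simplex (j + m) t) (ht : 0 < t) (z : Fin (j + m) → Euc d) (hj : j < j + m + 1) :
    bridgeDensity d t x y s z * Qratio d t x y s z ⟨j, hj⟩ =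
      jointDensity d x (fun i : Fin j => s (Fin.castAdd m i)) (fun i => z (Fin.castAdd m i)) *
      jointDensity d y (fun i : Fin m => t - s (Fin.natAdd j i.rev))
        (fun i => z (Fin.natAdd j i.rev)) := by
  let S : ℕ → ℝ := fun i =>
    if i = 0 then 0 else if h : i - 1 < j + m then s ⟨i - 1, h⟩ else t
  let Z : ℕ → Euc d := fun i =>
    if i = 0 then x else if h : i - 1 < j + m then z ⟨i - 1, h⟩ else y
  have hSs (i : Fin (j + m)) : S (i + 1) = s i := by simp [S]
  have hZz (i : Fin (j + m)) : Z (i + 1) = z i := by simp [Z]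
  have hSt : S (j + m + 1) = t := by simp [S]
  have hZy : Z (j + m + 1) = y := by simp [Z]
  have hS₀ : S 0 = 0 := by simp [S]
  have hZ₀ : Z 0 = x := by simp [Z]
  have hScons (i : Fin (j + m + 2)) :
      (Fin.cons 0 (Fin.snoc s t) : Fin (j + m + 2) → ℝ) i = S i := by
    refine Fin.cases (by simp [hS₀]) (fun i => ?_) i
    refine Fin.lastCases (by simp [hSt]) (fun i => ?_) i
    simp [hSs]
  have hZcons (i : Fin (j + m + 2)) :
      (Fin.cons x (Fin.snoc z y) : Fin (j + m + 2) → Euc d) i = Z i := by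
    refine Fin.cases (by simp [hZ₀]) (fun i => ?_) i
    refine Fin.lastCases (by simp [hZy]) (fun i => ?_) i
    simp [hZz]
  have hbridge : jointDensity d x (Fin.snoc s t : Fin (j + m + 1) → ℝ) (Fin.snoc z y) =
      ∏ i ∈ Finset.range (j + m + 1), heatKernel d (S (i + 1) - S i) (Z (i + 1) - Z i) := by
    refine jointDensity_eq_prod_range S Z hS₀ hZ₀ (fun i => ?_) fun i => ?_
    · simpa using (hScons i.succ).symm
    · simpa using (hZcons i.succ).symm
  have hleft : jointDensity d x (fun i : Fin j => s (Fin.castAdd m i))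
      (fun i => z (Fin.castAdd m i)) =
      ∏ i ∈ Finset.range j, heatKernel d (S (i + 1) - S i) (Z (i + 1) - Z i) :=
    jointDensity_eq_prod_range S Z hS₀ hZ₀ (fun i => hSs (Fin.castAdd m i))
      fun i => hZz (Fin.castAdd m i)
  have hidx (i : Fin m) : j + m + 1 - ((i : ℕ) + 1) = (Fin.natAdd j i.rev : ℕ) + 1 := by
    simp [Fin.val_rev]; omega
  have hright : jointDensity d y (fun i : Fin m => t - s (Fin.natAdd j i.rev))
        (fun i => z (Fin.natAdd j i.rev)) =
      ∏ i ∈ Finset.range m,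
        heatKernel d (S (j + 1 + i + 1) - S (j + 1 + i)) (Z (j + 1 + i + 1) - Z (j + 1 + i)) := by
    rw [jointDensity_eq_prod_range (fun i => t - S (j + m + 1 - i)) (fun i => Z (j + m + 1 - i))
      (by simp [hSt]) (by simp [hZy]) (fun i => by rw [hidx, hSs]) fun i => by rw [hidx, hZz],
      ← Finset.prod_range_reflect]
    refine Finset.prod_congr rfl fun i hi => ?_
    have hi := Finset.mem_range.1 hi
    rw [show j + m + 1 - (m - 1 - i + 1) = j + 1 + i by omega,
      show j + m + 1 - (m - 1 - i) = j + 1 + i + 1 by omega, heatKernel_sub_comm]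
    congr 1
    ring
  have hQ : Qratio d t x y s z ⟨j, hj⟩ =
      heatKernel d t (y - x) / heatKernel d (S (j + 1) - S j) (Z (j + 1) - Z j) := by
    rw [Qratio, hScons, hScons, hZcons, hZcons]
    simp
  have hinc : 0 < S (j + 1) - S j := by
    rcases Nat.eq_zero_or_pos m with rfl | hm
    · rcases Nat.eq_zero_or_pos j with rfl | hj'
      · simpa [hS₀, hSt] using hSt.symm ▸ ht
      · have h := hSs ⟨j - 1, by omega⟩
        simp only [Nat.sub_add_cancel hj'] at h
        rw [h, show S (j + 1) = t from hSt]
        exact sub_pos.2 (hs.2 _).2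
    · have h := hSs ⟨j, by omega⟩
      simp only at h
      rcases Nat.eq_zero_or_pos j with rfl | hj'
      · rw [h, hS₀, sub_zero]
        exact (hs.2 _).1
      · have h' := hSs ⟨j - 1, by omega⟩
        simp only [Nat.sub_add_cancel hj'] at h'
        rw [h, h']
        exact sub_pos.2 (hs.1 (Fin.lt_def.2 (by simp; omega)))
  have h1 := (heatKernel_pos hinc (Z (j + 1) - Z j)).ne'
  have h2 := (heatKernel_pos ht (y - x)).ne'
  rw [bridgeDensity, hbridge, hleft, hright, hQ, show j + m + 1 = (j + 1) + m by omega,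
    Finset.prod_range_add, Finset.prod_range_succ]
  field_simp

theorem lintegral_split_rev {E : Type*} [MeasureSpace E] [SigmaFinite (volume : Measure E)]
    {j m : ℕ} {f : (Fin j → E) → ℝ≥0∞} {g : (Fin m → E) → ℝ≥0∞}
    (hf : Measurable f) (hg : Measurable g) :
    ∫⁻ z : Fin (j + m) → E, f (fun i => z (Fin.castAdd m i)) * g (fun i => z (Fin.natAdd j i.rev)) =
      (∫⁻ z, f z) * ∫⁻ z, g z := by
  let e : Fin j ⊕ Fin m ≃ Fin (j + m) :=
    (Equiv.sumCongr (Equiv.refl _) Fin.revPerm).trans finSumFinEquiv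
  have h1 := (volume_measurePreserving_piCongrLeft (fun _ : Fin (j + m) => E) e).symm
  have h2 := volume_measurePreserving_sumPiEquivProdPi (fun _ : Fin j ⊕ Fin m => E)
  rw [← lintegral_prod_mul hf.aemeasurable hg.aemeasurable]
  exact (h2.comp h1).lintegral_comp_emb
    ((MeasurableEquiv.measurableEmbedding _).comp (MeasurableEquiv.measurableEmbedding _))
    fun p => f p.1 * g p.2

theorem lintegral_enorm_bridgeDensity_mul_Qratio {d j m : ℕ} {t : ℝ} (x y : Euc d)
    {v : Euc d → ℝ} (hvm : Measurable v) (hv0 : ∀ z, 0 ≤ v z) {s : Fin (j + m) → ℝ}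
    (hs : s ∈ simplex (j + m) t) (ht : 0 < t) (hj : j < j + m + 1) :
    ∫⁻ z, ‖bridgeDensity d t x y s z * Qratio d t x y s z ⟨j, hj⟩ * ∏ i, v (z i)‖ₑ =
      (∫⁻ z, ENNReal.ofReal (jointDensity d x (fun i : Fin j => s (Fin.castAdd m i)) z) *
        ∏ i, ENNReal.ofReal (v (z i))) *
      ∫⁻ z, ENNReal.ofReal
          (jointDensity d y (fun i : Fin m => t - s (Fin.natAdd j i.rev)) z) *
        ∏ i, ENNReal.ofReal (v (z i)) := by
  have hmeas {n : ℕ} (a : Euc d) (r : Fin n → ℝ) :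
      Measurable fun z => ENNReal.ofReal (jointDensity d a r z) *
        ∏ i, ENNReal.ofReal (v (z i)) :=
    (measurable_jointDensity a r).ennreal_ofReal.mul <|
      Finset.measurable_fun_prod _ fun i _ => (hvm.comp (measurable_pi_apply i)).ennreal_ofReal
  rw [← lintegral_split_rev (hmeas x _) (hmeas y _)]
  refine lintegral_congr fun z => ?_
  have hx := (jointDensity_pos x (s := fun i : Fin j => s (Fin.castAdd m i))
    (hs.1.comp (Fin.strictMono_castAdd m)) (fun i => (hs.2 _).1) fun i => z (Fin.castAdd m i)).le
  have hy := (jointDensity_pos y (s := fun i : Fin m => t - s (Fin.natAdd j i.rev))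
    (fun a b hab => sub_lt_sub_left (hs.1 (Fin.strictMono_natAdd j (Fin.rev_lt_rev.2 hab))) t)
    (fun i => sub_pos.2 (hs.2 _).2) fun i => z (Fin.natAdd j i.rev)).le
  rw [bridgeDensity_mul_Qratio x y hs ht, Real.enorm_of_nonneg
    (mul_nonneg (mul_nonneg hx hy) (Finset.prod_nonneg fun i _ => hv0 _)),
    Fin.prod_univ_add, ENNReal.ofReal_mul (mul_nonneg hx hy), ENNReal.ofReal_mul hx,
    ENNReal.ofReal_mul (Finset.prod_nonneg fun i _ => hv0 _),
    ENNReal.ofReal_prod_of_nonneg fun i _ => hv0 _, ENNReal.ofReal_prod_of_nonneg fun i _ => hv0 _,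
    ← Equiv.prod_comp Fin.revPerm fun i : Fin m => ENNReal.ofReal (v (z (Fin.natAdd j i)))]
  simp only [Fin.revPerm_apply]
  exact mul_mul_mul_comm _ _ _ _

/-! ### Path integrals -/

theorem ofReal_pathInt {Ω : Type*} {d : ℕ} {v : Euc d → ℝ} (hvm : Measurable v) {C : ℝ}
    (hC : ∀ z, |v z| ≤ C) (hv0 : ∀ z, 0 ≤ v z) {X : ℝ → Ω → Euc d} {ω : Ω}
    (hX : Continuous fun s => X s ω) (t : ℝ) :
    ENNReal.ofReal (pathInt v X t ω) = ∫⁻ s in Set.Ioc 0 t, ENNReal.ofReal (v (X s ω)) := by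
  refine ofReal_integral_eq_lintegral_ofReal ?_ (.of_forall fun s => hv0 _)
  exact Measure.integrableOn_of_bounded (M := C) (by simp)
    (hvm.comp hX.measurable).aestronglyMeasurable (.of_forall fun s => hC _)

theorem pathInt_nonneg {Ω : Type*} {d : ℕ} {v : Euc d → ℝ} (hv0 : ∀ z, 0 ≤ v z)
    (X : ℝ → Ω → Euc d) (t : ℝ) (ω : Ω) :
    0 ≤ pathInt v X t ω :=
  integral_nonneg fun _ => hv0 _

theorem pathInt_le {Ω : Type*} {d : ℕ} {v : Euc d → ℝ} {C : ℝ} (hC : ∀ z, |v z| ≤ C)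
    (X : ℝ → Ω → Euc d) {t : ℝ} (ht : 0 < t) (ω : Ω) : pathInt v X t ω ≤ C * t := by
  have h : ‖∫ s in Set.Ioc 0 t, v (X s ω)‖ ≤ C * volume.real (Set.Ioc 0 t) :=
    norm_setIntegral_le_of_norm_le_const measure_Ioc_lt_top fun s _ => hC _
  refine (le_abs_self _).trans (h.trans_eq ?_)
  simp [ht.le]

/-! ### Measurability and finite-dimensional moments of Brownian motion -/

section BrownianMotion

variable {Ω : Type*} [MeasureSpace Ω] {d : ℕ}

theorem IsBrownianMotion.aemeasurable_fdd {x : Euc d} {W : ℝ → Ω → Euc d}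
    (hW : IsBrownianMotion x W) {k : ℕ} {s : Fin (k + 1) → ℝ} (hs : StrictMono s)
    (hs₀ : ∀ i, 0 < s i) :
    AEMeasurable (fun ω (i : Fin (k + 1)) => W (s i) ω) (ℙ : Measure Ω) := by
  refine aemeasurable_of_map_neZero ⟨?_⟩
  rw [hW.2.2 k s hs hs₀, Ne, withDensity_eq_zero_iff
    (measurable_jointDensity x s).ennreal_ofReal.aemeasurable]
  intro h
  obtain ⟨z, hz⟩ := h.exists
  exact (ENNReal.ofReal_pos.2 (jointDensity_pos x hs hs₀ z)).ne' hz

theorem IsBrownianMotion.aemeasurable {x : Euc d} {W : ℝ → Ω → Euc d}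
    (hW : IsBrownianMotion x W) {s : ℝ} (hs : 0 < s) : AEMeasurable (W s) (ℙ : Measure Ω) :=
  (hW.aemeasurable_fdd (k := 0) (s := fun _ => s) (fun a b h => absurd h (by omega)) fun _ => hs).eval 0

theorem IsBrownianMotion.lintegral_prod [IsProbabilityMeasure (ℙ : Measure Ω)] {x : Euc d}
    {W : ℝ → Ω → Euc d} (hW : IsBrownianMotion x W) {k : ℕ} {s : Fin k → ℝ} (hs : StrictMono s)
    (hs₀ : ∀ i, 0 < s i) {F : Euc d → ℝ≥0∞} (hF : Measurable F) :
    ∫⁻ ω, ∏ i, F (W (s i) ω) = ∫⁻ z, ENNReal.ofReal (jointDensity d x s z) * ∏ i, F (z i) := by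
  cases k with
  | zero => simp [jointDensity, volume_pi]
  | succ k =>
    have hG : Measurable fun z : Fin (k + 1) → Euc d => ∏ i, F (z i) :=
      Finset.measurable_fun_prod _ fun i _ => hF.comp (measurable_pi_apply i)
    rw [← lintegral_map' (f := fun z : Fin (k + 1) → Euc d => ∏ i, F (z i)) hG.aemeasurable
      (hW.aemeasurable_fdd hs hs₀), hW.2.2 k s hs hs₀,
      lintegral_withDensity_eq_lintegral_mul _ (measurable_jointDensity x s).ennreal_ofReal hG]
    rfl

/-- A Brownian motion agrees almost surely, at all nonnegative times simultaneously, with a jointly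
measurable process. -/
theorem IsBrownianMotion.exists_measurable_modification {x : Euc d} {W : ℝ → Ω → Euc d}
    (hW : IsBrownianMotion x W) :
    ∃ V : ℝ → Ω → Euc d, Measurable (Function.uncurry V) ∧
      ∀ᵐ ω, ∀ s, 0 ≤ s → V s ω = W s ω := by
  classical
  let M : ℝ → Ω → Euc d := fun s =>
    if h : 0 < s then (hW.aemeasurable h).mk (W s) else fun _ => x
  have hM (s : ℝ) : Measurable (M s) := by
    by_cases h : 0 < s
    · simpa [M, h] using (hW.aemeasurable h).measurable_mk
    · simp [M, h]
  have hWM : ∀ᵐ ω, ∀ q : ℚ, 0 < (q : ℝ) → W q ω = M q ω := by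
    refine ae_all_iff.2 fun q => ?_
    by_cases h : 0 < (q : ℝ)
    · filter_upwards [(hW.aemeasurable h).ae_eq_mk] with ω hω _
      simpa only [M, h, dif_pos] using hω
    · exact .of_forall fun ω hq => absurd hq h
  obtain ⟨N, hNsub, hNm, hN⟩ := exists_measurable_superset_of_null (ae_iff.1 hWM)
  have hWN {ω : Ω} (hω : ω ∉ N) (q : ℚ) (hq : 0 < (q : ℝ)) : W q ω = M q ω := by
    by_contra hne
    exact hω (hNsub fun h => hne (h q hq))
  let V : ℝ → Ω → Euc d := fun s ω => if ω ∈ N then x else W (max s 0) ω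
  refine ⟨V, measurable_uncurry_of_continuous_of_measurable (fun ω => ?_) fun s => ?_, ?_⟩
  · by_cases hω : ω ∈ N
    · simp only [V, hω, if_true]
      exact continuous_const
    · simp only [V, hω, if_false]
      exact (hW.2.1 ω).comp (continuous_id.max continuous_const)
  · obtain ⟨u, -, hu, hlim⟩ := Real.exists_seq_rat_strictAnti_tendsto (max s 0)
    refine measurable_of_tendsto_metrizable
      (f := fun n ω => if ω ∈ N then x else M (u n) ω)
      (fun n => Measurable.ite hNm measurable_const (hM _)) (tendsto_pi_nhds.2 fun ω => ?_)
    by_cases hω : ω ∈ N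
    · simp [V, hω]
    · simp only [V, hω, if_false]
      refine Tendsto.congr (fun n => hWN hω (u n) ((le_max_right s 0).trans_lt (hu n))) ?_
      exact ((hW.2.1 ω).tendsto _).comp hlim
  · filter_upwards [measure_eq_zero_iff_ae_notMem.1 hN] with ω hω s hs
    simp [V, hω, hs]

theorem aemeasurable_pathInt {v : Euc d → ℝ} (hvm : Measurable v) {x : Euc d} {W : ℝ → Ω → Euc d}
    (hW : IsBrownianMotion x W) (t : ℝ) : AEMeasurable (pathInt v W t) (ℙ : Measure Ω) := by
  obtain ⟨V, hVm, hV⟩ := hW.exists_measurable_modification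
  have hm : StronglyMeasurable fun ω => ∫ s in Set.Ioc 0 t, v (V s ω) :=
    ((hvm.comp hVm).stronglyMeasurable).integral_prod_left'
  refine ⟨_, hm.measurable, ?_⟩
  filter_upwards [hV] with ω hω
  exact setIntegral_congr_fun measurableSet_Ioc fun s hs => by rw [hω s hs.1.le]

theorem lintegral_prod_mul_prod_of_indepFun {x y : Euc d} {W W' : ℝ → Ω → Euc d}
    (hWx : IsBrownianMotion x W) (hWy : IsBrownianMotion y W')
    (hindep : IndepFun (fun ω (s : ℝ) => W s ω) (fun ω (s : ℝ) => W' s ω) ℙ)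
    {F : Euc d → ℝ≥0∞} (hF : Measurable F) {j m : ℕ} {s : Fin j → ℝ} {r : Fin m → ℝ}
    (hs : ∀ i, 0 < s i) (hr : ∀ i, 0 < r i) :
    ∫⁻ ω, (∏ i, F (W (s i) ω)) * ∏ i, F (W' (r i) ω) =
      (∫⁻ ω, ∏ i, F (W (s i) ω)) * ∫⁻ ω, ∏ i, F (W' (r i) ω) := by
  have hφ {n : ℕ} (u : Fin n → ℝ) : Measurable fun p : ℝ → Euc d => ∏ i, F (p (u i)) :=
    Finset.measurable_fun_prod _ fun i _ => hF.comp (measurable_pi_apply (u i))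
  exact lintegral_mul_eq_lintegral_mul_lintegral_of_indepFun''
    (Finset.aemeasurable_fun_prod _ fun i _ => hF.comp_aemeasurable (hWx.aemeasurable (hs i)))
    (Finset.aemeasurable_fun_prod _ fun i _ => hF.comp_aemeasurable (hWy.aemeasurable (hr i)))
    (hindep.comp (hφ s) (hφ r))

theorem lintegral_enorm_bridge_eq_lintegral_prod_ite [IsProbabilityMeasure (ℙ : Measure Ω)]
    {x y : Euc d} {W W' : ℝ → Ω → Euc d}
    (hWx : IsBrownianMotion x W) (hWy : IsBrownianMotion y W')
    (hindep : IndepFun (fun ω (s : ℝ) => W s ω) (fun ω (s : ℝ) => W' s ω) ℙ)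
    {v : Euc d → ℝ} (hvm : Measurable v) (hv0 : ∀ z, 0 ≤ v z) {t : ℝ} (ht : 0 < t) {k : ℕ}
    {s : Fin k → ℝ} (hs : s ∈ simplex k t) (j : Fin (k + 1)) :
    ∫⁻ z, ‖bridgeDensity d t x y s z * Qratio d t x y s z j * ∏ i, v (z i)‖ₑ =
      ∫⁻ ω, ∏ i : Fin k, if (i : ℕ) < j then ENNReal.ofReal (v (W (s i) ω))
        else ENNReal.ofReal (v (W' (t - s i) ω)) := by
  obtain ⟨j, hj⟩ := j
  obtain ⟨m, rfl⟩ := Nat.exists_eq_add_of_le (Nat.lt_succ_iff.1 hj)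
  have hr (i : Fin m) : 0 < t - s (Fin.natAdd j i.rev) := sub_pos.2 (hs.2 _).2
  rw [lintegral_enorm_bridgeDensity_mul_Qratio x y hvm hv0 hs ht hj,
    ← hWx.lintegral_prod (s := fun i : Fin j => s (Fin.castAdd m i))
      (hs.1.comp (Fin.strictMono_castAdd m)) (fun i => (hs.2 _).1) hvm.ennreal_ofReal,
    ← hWy.lintegral_prod (s := fun i : Fin m => t - s (Fin.natAdd j i.rev))
      (fun a b hab => sub_lt_sub_left (hs.1 (Fin.strictMono_natAdd j (Fin.rev_lt_rev.2 hab))) t)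
      hr hvm.ennreal_ofReal,
    ← lintegral_prod_mul_prod_of_indepFun hWx hWy hindep hvm.ennreal_ofReal
      (fun i => (hs.2 _).1) hr]
  refine lintegral_congr fun ω => ?_
  rw [Fin.prod_univ_add]
  simp only [Fin.val_castAdd, Fin.is_lt, if_true, Fin.val_natAdd, not_lt.2 (Nat.le_add_right _ _),
    if_false]
  rw [← Equiv.prod_comp Fin.revPerm fun i : Fin m =>
    ENNReal.ofReal (v (W' (t - s (Fin.natAdd j i)) ω))]
  rfl

theorem setLIntegral_simplex_lintegral_prod_add_le [IsProbabilityMeasure (ℙ : Measure Ω)]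
    {x y : Euc d} {W W' : ℝ → Ω → Euc d}
    (hWx : IsBrownianMotion x W) (hWy : IsBrownianMotion y W')
    {F : Euc d → ℝ≥0∞} (hF : Measurable F) (t : ℝ) (k : ℕ) :
    (k.factorial : ℝ≥0∞) * ∫⁻ s in simplex k t, ∫⁻ ω, ∏ i, (F (W (s i) ω) + F (W' (t - s i) ω)) ≤
      ∫⁻ ω, ((∫⁻ r in Set.Ioc 0 t, F (W r ω)) + ∫⁻ r in Set.Ioc 0 t, F (W' r ω)) ^ k := by
  obtain ⟨V, hVm, hV⟩ := hWx.exists_measurable_modification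
  obtain ⟨V', hVm', hV'⟩ := hWy.exists_measurable_modification
  have hm : Measurable fun p : (Fin k → ℝ) × Ω =>
      ∏ i, (F (V (p.1 i) p.2) + F (V' (t - p.1 i) p.2)) := by
    refine Finset.measurable_fun_prod _ fun i _ => ?_
    have hi : Measurable fun p : (Fin k → ℝ) × Ω => p.1 i :=
      (measurable_pi_apply i).comp measurable_fst
    exact (hF.comp (hVm.comp (hi.prodMk measurable_snd))).add
      (hF.comp (hVm'.comp ((hi.const_sub t).prodMk measurable_snd)))
  calc (k.factorial : ℝ≥0∞) *
        ∫⁻ s in simplex k t, ∫⁻ ω, ∏ i, (F (W (s i) ω) + F (W' (t - s i) ω))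
      = k.factorial *
        ∫⁻ s in simplex k t, ∫⁻ ω, ∏ i, (F (V (s i) ω) + F (V' (t - s i) ω)) := by
        congr 1
        refine setLIntegral_congr_fun (measurableSet_simplex k t) fun s hs => ?_
        refine lintegral_congr_ae ?_
        filter_upwards [hV, hV'] with ω hω hω'
        refine Finset.prod_congr rfl fun i _ => ?_
        rw [hω _ (hs.2 i).1.le, hω' _ (sub_pos.2 (hs.2 i).2).le]
    _ = ∫⁻ ω, k.factorial *
        ∫⁻ s in simplex k t, ∏ i, (F (V (s i) ω) + F (V' (t - s i) ω)) := by
        rw [lintegral_lintegral_swap hm.aemeasurable,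
          lintegral_const_mul _ hm.lintegral_prod_left']
    _ ≤ ∫⁻ ω, (∫⁻ r in Set.Ioc 0 t, (F (V r ω) + F (V' (t - r) ω))) ^ k := by
        refine lintegral_mono fun ω => factorial_mul_setLIntegral_simplex_le
          (f := fun r => F (V r ω) + F (V' (t - r) ω)) ?_ k t
        exact (hF.comp hVm.of_uncurry_right).add
          (hF.comp (hVm'.of_uncurry_right.comp (measurable_id.const_sub t)))
    _ = _ := by
        refine lintegral_congr_ae ?_
        filter_upwards [hV, hV'] with ω hω hω'
        rw [lintegral_add_left (f := fun r => F (V r ω)) (hF.comp hVm.of_uncurry_right),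
          setLIntegral_Ioc_sub_left fun r => F (V' r ω)]
        congr 2 <;> refine setLIntegral_congr_fun measurableSet_Ioc fun r hr => ?_
        · rw [hω r hr.1.le]
        · rw [hω' r hr.1.le]

end BrownianMotion

/-- The comparison inequality (lb:indept): moments of the sum of two independent free
Brownian path integrals dominate bridge integrals weighted by the density ratios `Q_j`. -/
theorem stmt12 (d : ℕ) (hd : 3 ≤ d) (v : Euc d → ℝ)
    (hvm : Measurable v) (hvb : ∃ C : ℝ, ∀ z, |v z| ≤ C)
    (hvs : ∃ R : ℝ, ∀ z, v z ≠ 0 → ‖z‖ ≤ R) (hv0 : ∀ z, 0 ≤ v z)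
    {Ω : Type*} [MeasureSpace Ω] [IsProbabilityMeasure (ℙ : Measure Ω)]
    (x y : Euc d) (W W' : ℝ → Ω → Euc d)
    (hWx : IsBrownianMotion x W) (hWy : IsBrownianMotion y W')
    (hindep : IndepFun (fun ω (s : ℝ) => W s ω) (fun ω (s : ℝ) => W' s ω) ℙ) :
    ∀ (t : ℝ), 0 < t → ∀ (k : ℕ),
      (∑ j : Fin (k + 1), ∫ s in simplex k t, ∫ z : Fin k → Euc d,
          bridgeDensity d t x y s z * Qratio d t x y s z j * ∏ i : Fin k, v (z i)) ≤
        (∫ ω, (pathInt v W t ω + pathInt v W' t ω) ^ k) / (Nat.factorial k : ℝ) := by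
  intro t ht k
  obtain ⟨C, hC⟩ := hvb
  have hS0 (ω : Ω) : 0 ≤ pathInt v W t ω + pathInt v W' t ω :=
    add_nonneg (pathInt_nonneg hv0 W t ω) (pathInt_nonneg hv0 W' t ω)
  have hint : Integrable fun ω => (pathInt v W t ω + pathInt v W' t ω) ^ k := by
    refine .of_bound (((aemeasurable_pathInt hvm hWx t).add
      (aemeasurable_pathInt hvm hWy t)).pow_const k).aestronglyMeasurable
      ((C * t + C * t) ^ k) (.of_forall fun ω => ?_)
    rw [Real.norm_of_nonneg (pow_nonneg (hS0 ω) k)]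
    exact pow_le_pow_left₀ (hS0 ω) (add_le_add (pathInt_le hC W ht ω) (pathInt_le hC W' ht ω)) k
  have hmoment : ENNReal.ofReal (∫ ω, (pathInt v W t ω + pathInt v W' t ω) ^ k) =
      ∫⁻ ω, ((∫⁻ r in Set.Ioc 0 t, ENNReal.ofReal (v (W r ω))) +
        ∫⁻ r in Set.Ioc 0 t, ENNReal.ofReal (v (W' r ω))) ^ k := by
    rw [ofReal_integral_eq_lintegral_ofReal hint (.of_forall fun ω => pow_nonneg (hS0 ω) k)]
    refine lintegral_congr fun ω => ?_
    rw [ENNReal.ofReal_pow (hS0 ω),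
      ENNReal.ofReal_add (pathInt_nonneg hv0 W t ω) (pathInt_nonneg hv0 W' t ω),
      ofReal_pathInt hvm hC hv0 (hWx.2.1 ω), ofReal_pathInt hvm hC hv0 (hWy.2.1 ω)]
  have hfac : (0 : ℝ) < k.factorial := by positivity
  rw [le_div_iff₀' hfac]
  refine (ENNReal.ofReal_le_ofReal_iff (integral_nonneg fun ω => pow_nonneg (hS0 ω) k)).1 ?_
  rw [hmoment, ENNReal.ofReal_mul hfac.le, ENNReal.ofReal_natCast]
  refine le_trans ?_
    (setLIntegral_simplex_lintegral_prod_add_le hWx hWy hvm.ennreal_ofReal t k)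
  refine mul_le_mul_right ?_ _
  refine (Real.ofReal_le_enorm _).trans ((enorm_sum_le _ _).trans ?_)
  calc ∑ j, ‖∫ s in simplex k t, ∫ z : Fin k → Euc d,
          bridgeDensity d t x y s z * Qratio d t x y s z j * ∏ i, v (z i)‖ₑ
      ≤ ∑ j, ∫⁻ s in simplex k t, ∫⁻ z : Fin k → Euc d,
          ‖bridgeDensity d t x y s z * Qratio d t x y s z j * ∏ i, v (z i)‖ₑ :=
        Finset.sum_le_sum fun j _ => (enorm_integral_le_lintegral_enorm _).trans
          (lintegral_mono fun s => enorm_integral_le_lintegral_enorm _)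
    _ ≤ ∫⁻ s in simplex k t, ∑ j, ∫⁻ z : Fin k → Euc d,
          ‖bridgeDensity d t x y s z * Qratio d t x y s z j * ∏ i, v (z i)‖ₑ :=
        sum_lintegral_le_lintegral_sum _ _ _
    _ ≤ _ := by
        refine setLIntegral_mono' (measurableSet_simplex k t) fun s hs => ?_
        simp only [lintegral_enorm_bridge_eq_lintegral_prod_ite hWx hWy hindep hvm hv0 ht hs]
        exact (sum_lintegral_le_lintegral_sum _ _ _).trans
          (lintegral_mono fun ω => sum_prod_ite_le_prod_add _ _)

end
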